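/- For every acceptance mode (σ,ρ) with σ ∈ {ran, inf}, ρ ∈ {⊓, ⊆, =} and (σ,ρ) ∉ {(ran,⊓), (ran,=)}, the family of ω-languages (σ,ρ,l)-accepted by context-sensitive ω-grammars equals the family of ω-languages (σ,ρ,l)-accepted by context-free ω-grammars: 𝓛_{σ,ρ,l}(ω-CSG) = 𝓛_{σ,ρ,l}(ω-CFG). -/

import Mathlib

namespace OmegaFormal

/-- σ component of an acceptance mode: `ran` (occurs at least once)
or `inf` (occurs infinitely often). -/
inductive AccSigma | ran | inf
deriving DecidableEq

/-- ρ component of an acceptance mode: `cap` (nonempty intersection, ⊓),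
`sub` (⊆) or `eq` (=). -/
inductive AccRho | cap | sub | eq
deriving DecidableEq

/-- derivation mode: leftmost (`l`) or normal (`nl`). -/
inductive DerivMode | l | nl
deriving DecidableEq

/-- `sigmaSet σ f` is ran(f) resp. inf(f). -/
def sigmaSet {Q : Type _} : AccSigma → (ℕ → Q) → Set Q
  | .ran, f => Set.range f
  | .inf, f => {q | ∀ n : ℕ, ∃ m : ℕ, n ≤ m ∧ f m = q}

/-- the binary relation denoted by ρ. -/
def rhoRel {Q : Type _} : AccRho → Set Q → Set Q → Prop
  | .cap, A, B => (A ∩ B).Nonempty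
  | .sub, A, B => A ⊆ B
  | .eq,  A, B => A = B

/-- f is (σ,ρ)-accepting w.r.t. the set 𝓕 of designated sets. -/
def IsAccepting {Q : Type _} (σ : AccSigma) (ρ : AccRho) (𝓕 : Set (Set Q)) (f : ℕ → Q) : Prop :=
  ∃ F ∈ 𝓕, rhoRel ρ (sigmaSet σ f) F

/-- the finite word `l` coincides with the prefix of the ω-word `u`. -/
def MatchesPrefix {T : Type _} (l : List T) (u : ℕ → T) : Prop :=
  ∀ (k : ℕ) (h : k < l.length), l.get ⟨k, h⟩ = u k

/-- the maximal terminal prefix of a sentential form. -/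
def termPrefix {N T : Type _} : List (N ⊕ T) → List T
  | [] => []
  | (Sum.inl _) :: _ => []
  | (Sum.inr a) :: l => a :: termPrefix l

/-- A phrase structure ω-grammar `G = (N, T, P, S, 𝓕)`:
`N` nonterminals, `T` terminals, `P` named productions `p : lhs p → rhs p`
with `lhs p ∈ N⁺`, `rhs p ∈ (N ∪ T)*`, start symbol, and
production repetition sets `acc ⊆ 2^P`. -/
structure OmegaPSG (T : Type) where
  N : Type
  [fintypeN : Fintype N]
  P : Type
  [fintypeP : Fintype P]
  lhs : P → List N
  lhs_ne : ∀ p : P, lhs p ≠ []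
  rhs : P → List (N ⊕ T)
  start : N
  acc : Set (Set P)

namespace OmegaPSG

variable {T : Type} (G : OmegaPSG T)

/-- one (normal) rewriting step using production p. -/
def Step (p : G.P) (x y : List (G.N ⊕ T)) : Prop :=
  ∃ u v : List (G.N ⊕ T),
    x = u ++ (G.lhs p).map Sum.inl ++ v ∧ y = u ++ G.rhs p ++ v

/-- one leftmost rewriting step: the rewritten occurrence starts at the
leftmost nonterminal, i.e. everything to its left is terminal. -/
def LStep (p : G.P) (x y : List (G.N ⊕ T)) : Prop :=
  ∃ u v : List (G.N ⊕ T), (∀ s ∈ u, ∃ a : T, s = Sum.inr a) ∧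
    x = u ++ (G.lhs p).map Sum.inl ++ v ∧ y = u ++ G.rhs p ++ v

def StepOf : DerivMode → G.P → List (G.N ⊕ T) → List (G.N ⊕ T) → Prop
  | .l => G.LStep
  | .nl => G.Step

/-- `L_{σ,ρ,π}(G)`: ω-words admitting an infinite π-derivation from S whose
growing terminal prefixes spell the word and whose production sequence is
(σ,ρ)-accepting w.r.t. `G.acc`. -/
def Lang (σ : AccSigma) (ρ : AccRho) (π : DerivMode) : Set (ℕ → T) :=
  {u | ∃ (s : ℕ → List (G.N ⊕ T)) (d : ℕ → G.P),
    s 0 = [Sum.inl G.start] ∧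
    (∀ i : ℕ, G.StepOf π (d i) (s i) (s (i + 1))) ∧
    (∀ n : ℕ, ∃ i : ℕ, n ≤ (termPrefix (s i)).length) ∧
    (∀ i : ℕ, MatchesPrefix (termPrefix (s i)) u) ∧
    IsAccepting σ ρ G.acc d}

/-- context-free: every left-hand side is a single nonterminal. -/
def IsCFG : Prop := ∀ p : G.P, (G.lhs p).length = 1

/-- context-sensitive (monotonic): `|β| ≥ |α|` for every production. -/
def IsCSG : Prop := ∀ p : G.P, (G.lhs p).length ≤ (G.rhs p).length

/-- right linear: productions of the form `A → uB` or `A → u`, `u ∈ T*`. -/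
def IsRLG : Prop :=
  ∀ p : G.P, (G.lhs p).length = 1 ∧
    ∃ (w : List T) (B : Option G.N),
      G.rhs p = w.map Sum.inr ++ B.toList.map Sum.inl

/-- `G` is a grammar with `$`-boundary (PSG version): with `$` = `dollar`,
`S` = `S'`, every production has one of the forms
(1) α → β, α,β ∈ N⁺ (N = nonterminals other than `$`, `S`),
(2) S → $α, α ∈ N⁺, (3) $A → a$, (4) A → ε. -/
def HasDollarBoundary (dollar S' : G.N) : Prop :=
  dollar ≠ S' ∧ G.start = S' ∧
  ∀ p : G.P,
    ((dollar ∉ G.lhs p ∧ S' ∉ G.lhs p) ∧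
      ∃ β : List G.N, β ≠ [] ∧ dollar ∉ β ∧ S' ∉ β ∧ G.rhs p = β.map Sum.inl) ∨
    (G.lhs p = [S'] ∧ ∃ α : List G.N, α ≠ [] ∧ dollar ∉ α ∧ S' ∉ α ∧
      G.rhs p = Sum.inl dollar :: α.map Sum.inl) ∨
    (∃ A : G.N, A ≠ dollar ∧ A ≠ S' ∧ G.lhs p = [dollar, A] ∧
      ∃ a : T, G.rhs p = [Sum.inr a, Sum.inl dollar]) ∨
    (∃ A : G.N, A ≠ dollar ∧ A ≠ S' ∧ G.lhs p = [A] ∧ G.rhs p = [])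

/-- `G` is a grammar with `$`-boundary (CSG version): forms (1)-(3) only,
with `|α| ≤ |β|` in form (1). -/
def HasDollarBoundaryCSG (dollar S' : G.N) : Prop :=
  dollar ≠ S' ∧ G.start = S' ∧
  ∀ p : G.P,
    ((dollar ∉ G.lhs p ∧ S' ∉ G.lhs p) ∧
      ∃ β : List G.N, β ≠ [] ∧ dollar ∉ β ∧ S' ∉ β ∧ (G.lhs p).length ≤ β.length ∧
        G.rhs p = β.map Sum.inl) ∨
    (G.lhs p = [S'] ∧ ∃ α : List G.N, α ≠ [] ∧ dollar ∉ α ∧ S' ∉ α ∧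
      G.rhs p = Sum.inl dollar :: α.map Sum.inl) ∨
    (∃ A : G.N, A ≠ dollar ∧ A ≠ S' ∧ G.lhs p = [dollar, A] ∧
      ∃ a : T, G.rhs p = [Sum.inr a, Sum.inl dollar])

end OmegaPSG

/-- `𝓛_{σ,ρ,π}(X)` for the family `X` of ω-grammars over `T` satisfying `C`. -/
def GLang (T : Type) (C : OmegaPSG T → Prop) (σ : AccSigma) (ρ : AccRho) (π : DerivMode) :
    Set (Set (ℕ → T)) :=
  {L | ∃ G : OmegaPSG T, C G ∧ L = G.Lang σ ρ π}

/-- number of non-ε labels among `b 0, …, b (i-1)`. -/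
def someCount {A : Type _} (b : ℕ → Option A) (i : ℕ) : ℕ :=
  ((Finset.range i).filter fun j => (b j).isSome = true).card

/-- the (ε-allowing) label sequence `b` concatenates to the ω-word `u`. -/
def Spells {A : Type _} (b : ℕ → Option A) (u : ℕ → A) : Prop :=
  (∀ n : ℕ, ∃ i : ℕ, n ≤ someCount b i) ∧
  ∀ i : ℕ, ∀ a : A, b i = some a → a = u (someCount b i)

/-- A finite state ω-automaton `(Q, Σ, δ, q₀, 𝓕)`. -/
structure OmegaFSA (Sig : Type) where
  Q : Type
  [fintypeQ : Fintype Q]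
  init : Q
  trans : Q → Option Sig → Q → Prop
  acc : Set (Set Q)

/-- `L_{σ,ρ}(A)` for a finite state ω-automaton. -/
def OmegaFSA.Lang {Sig : Type} (A : OmegaFSA Sig) (σ : AccSigma) (ρ : AccRho) :
    Set (ℕ → Sig) :=
  {u | ∃ (r : ℕ → A.Q) (b : ℕ → Option Sig),
    r 0 = A.init ∧ (∀ i : ℕ, A.trans (r i) (b i) (r (i + 1))) ∧
    Spells b u ∧ IsAccepting σ ρ A.acc r}

/-- `𝓛_{σ,ρ}(ω-FSA)`. -/
def FSALang (Sig : Type) (σ : AccSigma) (ρ : AccRho) : Set (Set (ℕ → Sig)) :=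
  {L | ∃ A : OmegaFSA Sig, L = A.Lang σ ρ}

/-- A pushdown ω-automaton `(Q, Σ, Γ, δ, q₀, Z₀, 𝓕)`. -/
structure OmegaPDA (Sig : Type) where
  Q : Type
  [fintypeQ : Fintype Q]
  Γ : Type
  [fintypeΓ : Fintype Γ]
  init : Q
  Z0 : Γ
  trans : Q → Option Sig → Γ → Q → List Γ → Prop
  acc : Set (Set Q)

/-- `L_{σ,ρ}(D)` for a pushdown ω-automaton. -/
def OmegaPDA.Lang {Sig : Type} (D : OmegaPDA Sig) (σ : AccSigma) (ρ : AccRho) :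
    Set (ℕ → Sig) :=
  {u | ∃ (q : ℕ → D.Q) (st : ℕ → List D.Γ) (b : ℕ → Option Sig),
    q 0 = D.init ∧ st 0 = [D.Z0] ∧
    (∀ i : ℕ, ∃ (Z : D.Γ) (γ rest : List D.Γ),
      st i = Z :: rest ∧ D.trans (q i) (b i) Z (q (i + 1)) γ ∧ st (i + 1) = γ ++ rest) ∧
    Spells b u ∧ IsAccepting σ ρ D.acc q}

/-- `𝓛_{σ,ρ}(ω-PDA)`. -/
def PDALang (Sig : Type) (σ : AccSigma) (ρ : AccRho) : Set (Set (ℕ → Sig)) :=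
  {L | ∃ D : OmegaPDA Sig, L = D.Lang σ ρ}

/-- tape head moves. -/
inductive Move | L | R | S
deriving DecidableEq

def moveHead : Move → ℕ → ℕ
  | .L, n => n - 1
  | .R, n => n + 1
  | .S, n => n

/-- A single-tape Turing ω-machine `(Q, Σ, Γ, δ, q₀, 𝓕)` (Σ ⊆ Γ via `embed`). -/
structure OmegaTM (Sig : Type) where
  Q : Type
  [fintypeQ : Fintype Q]
  Γ : Type
  [fintypeΓ : Fintype Γ]
  embed : Sig → Γ
  embed_inj : Function.Injective embed
  init : Q
  trans : Q → Γ → Q → Γ → Move → Prop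
  acc : Set (Set Q)

/-- `L_{σ,ρ}(M)`: ω-words admitting a complete non-oscillating run whose state
sequence is (σ,ρ)-accepting. -/
def OmegaTM.Lang {Sig : Type} (M : OmegaTM Sig) (σ : AccSigma) (ρ : AccRho) :
    Set (ℕ → Sig) :=
  {u | ∃ (q : ℕ → M.Q) (tape : ℕ → ℕ → M.Γ) (pos : ℕ → ℕ),
    q 0 = M.init ∧ (∀ n : ℕ, tape 0 n = M.embed (u n)) ∧ pos 0 = 0 ∧
    (∀ i : ℕ, ∃ (g : M.Γ) (m : Move),
      M.trans (q i) (tape i (pos i)) (q (i + 1)) g m ∧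
      tape (i + 1) = Function.update (tape i) (pos i) g ∧
      pos (i + 1) = moveHead m (pos i)) ∧
    (∀ n : ℕ, ∃ i : ℕ, n ≤ pos i) ∧
    (∀ n : ℕ, ∃ i0 : ℕ, ∀ i : ℕ, i0 ≤ i → pos i ≠ n) ∧
    IsAccepting σ ρ M.acc q}

/-- `𝓛_{σ,ρ}(ω-TM)`. -/
def TMLang (Sig : Type) (σ : AccSigma) (ρ : AccRho) : Set (Set (ℕ → Sig)) :=
  {L | ∃ M : OmegaTM Sig, L = M.Lang σ ρ}

/-- An m-tape Turing ω-machine. -/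
structure OmegaMTM (m : ℕ) (Sig : Type) where
  Q : Type
  [fintypeQ : Fintype Q]
  Γ : Type
  [fintypeΓ : Fintype Γ]
  embed : Sig → Γ
  embed_inj : Function.Injective embed
  blank : Γ
  init : Q
  trans : Q → (Fin m → Γ) → Q → (Fin m → Γ) → (Fin m → Move) → Prop
  acc : Set (Set Q)

/-- `L_{σ,ρ}(M)` for an m-tape Turing ω-machine (`hm : 0 < m`; the input is on
the first tape, the other tapes are initially blank; the run must be complete
and non-oscillating on the first tape). -/
def OmegaMTM.Lang {m : ℕ} {Sig : Type} (M : OmegaMTM m Sig) (hm : 0 < m)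
    (σ : AccSigma) (ρ : AccRho) : Set (ℕ → Sig) :=
  {u | ∃ (q : ℕ → M.Q) (tape : ℕ → Fin m → ℕ → M.Γ) (pos : ℕ → Fin m → ℕ),
    q 0 = M.init ∧
    (∀ n : ℕ, tape 0 ⟨0, hm⟩ n = M.embed (u n)) ∧
    (∀ j : Fin m, j ≠ ⟨0, hm⟩ → ∀ n : ℕ, tape 0 j n = M.blank) ∧
    (∀ j : Fin m, pos 0 j = 0) ∧
    (∀ i : ℕ, ∃ (g : Fin m → M.Γ) (mv : Fin m → Move),
      M.trans (q i) (fun j => tape i j (pos i j)) (q (i + 1)) g mv ∧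
      (∀ j : Fin m, tape (i + 1) j = Function.update (tape i j) (pos i j) (g j)) ∧
      (∀ j : Fin m, pos (i + 1) j = moveHead (mv j) (pos i j))) ∧
    (∀ n : ℕ, ∃ i : ℕ, n ≤ pos i ⟨0, hm⟩) ∧
    (∀ n : ℕ, ∃ i0 : ℕ, ∀ i : ℕ, i0 ≤ i → pos i ⟨0, hm⟩ ≠ n) ∧
    IsAccepting σ ρ M.acc q}

/-- `𝓛_{σ,ρ}(m-ω-TM)`. -/
def MTMLang (Sig : Type) (m : ℕ) (hm : 0 < m) (σ : AccSigma) (ρ : AccRho) :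
    Set (Set (ℕ → Sig)) :=
  {L | ∃ M : OmegaMTM m Sig, L = M.Lang hm σ ρ}

/-- the ω-language `{aⁿbⁿ | n ≥ 1}^ω` over the alphabet `Bool`
(`false` = a, `true` = b). -/
def abLang : Set (ℕ → Bool) :=
  {u | ∃ n : ℕ → ℕ, (∀ i : ℕ, 1 ≤ n i) ∧
    ∀ i k : ℕ, k < 2 * n i →
      u ((∑ j ∈ Finset.range i, 2 * n j) + k) = decide (n i ≤ k)}

end OmegaFormal
open OmegaFormal

namespace OmegaFormal

/-- the elements occurring at least once (`ran`), resp. infinitely often (`inf`), in a sequence of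
sets. -/
def sigmaSetSeq {Q : Type*} : AccSigma → (ℕ → Set Q) → Set Q
  | .ran, D => {q | ∃ n, q ∈ D n}
  | .inf, D => {q | ∀ n : ℕ, ∃ m : ℕ, n ≤ m ∧ q ∈ D m}

/-- The consecutive blocks `[o n, o (n+1))` of a sequence have the same elements occurring once,
resp. infinitely often, as the sequence itself. -/
theorem sigmaSetSeq_blocks {Q : Type*} (σ : AccSigma) (d : ℕ → Q) (o : ℕ → ℕ) (h0 : o 0 = 0)
    (hmono : Monotone o) (hunb : ∀ k, ∃ n, k < o n) :
    sigmaSetSeq σ (fun n => {q | ∃ j, o n ≤ j ∧ j < o (n + 1) ∧ d j = q}) = sigmaSet σ d := by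
  classical
  have locate : ∀ k, ∃ n, o n ≤ k ∧ k < o (n + 1) := by
    intro k
    have hk := hunb k
    obtain ⟨m, hm⟩ : ∃ m, Nat.find hk = m + 1 := by
      refine Nat.exists_eq_succ_of_ne_zero fun h => ?_
      have := Nat.find_spec hk
      rw [h, h0] at this
      omega
    refine ⟨m, ?_, hm ▸ Nat.find_spec hk⟩
    exact not_lt.1 (Nat.find_min hk (by omega))
  ext q
  cases σ with
  | ran =>
    constructor
    · rintro ⟨n, j, -, -, rfl⟩
      exact ⟨j, rfl⟩
    · rintro ⟨j, rfl⟩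
      obtain ⟨n, h⟩ := locate j
      exact ⟨n, j, h.1, h.2, rfl⟩
  | inf =>
    constructor
    · intro h k
      obtain ⟨n, hn⟩ := hunb k
      obtain ⟨m, hm, j, hj, -, rfl⟩ := h n
      exact ⟨j, hn.le.trans ((hmono hm).trans hj), rfl⟩
    · intro h n
      obtain ⟨j, hj, rfl⟩ := h (o n)
      obtain ⟨m, h⟩ := locate j
      refine ⟨m, ?_, j, h.1, h.2, rfl⟩
      by_contra hlt
      have := hmono (show m + 1 ≤ n by omega)
      omega

/-- Taking the elements occurring once, resp. infinitely often, commutes with a finite union of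
labels. -/
theorem sigmaSetSeq_biUnion {Q Q' : Type*} [Finite Q'] (σ : AccSigma) (φ : Q' → Set Q)
    (D : ℕ → Set Q') :
    sigmaSetSeq σ (fun n => ⋃ q ∈ D n, φ q) = ⋃ q ∈ sigmaSetSeq σ D, φ q := by
  ext q
  cases σ with
  | ran =>
    simp only [sigmaSetSeq, Set.mem_iUnion, Set.mem_ofPred_eq]
    grind
  | inf =>
    simp only [sigmaSetSeq, Set.mem_iUnion, Set.mem_ofPred_eq]
    constructor
    · intro h
      by_contra hcon
      have hfin : ∀ q' : Q', ∃ n, q ∈ φ q' → ∀ m, n ≤ m → q' ∉ D m := by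
        intro q'
        by_cases hq : q ∈ φ q'
        · by_contra! hq'
          exact hcon ⟨q', fun n => (hq' n).2, hq⟩
        · exact ⟨0, fun h => absurd h hq⟩
      choose N hN using hfin
      obtain ⟨B, hB⟩ := (Set.finite_range N).bddAbove
      obtain ⟨m, hm, q', hq', hq⟩ := h B
      exact hN q' hq m ((hB ⟨q', rfl⟩).trans hm) hq'
    · rintro ⟨q', h, hq⟩ n
      obtain ⟨m, hm, hq'⟩ := h n
      exact ⟨m, hm, q', hq', hq⟩

theorem sigmaSetSeq_singleton {Q : Type*} (σ : AccSigma) (d : ℕ → Q) :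
    sigmaSetSeq σ (fun n => {d n}) = sigmaSet σ d := by
  ext q
  cases σ <;> simp [sigmaSetSeq, sigmaSet, eq_comm]

/-- Designated sets for a sequence over `Q'` whose elements are labelled by subsets of `Q`. -/
def pullbackAcc {Q Q' : Type*} (ρ : AccRho) (φ : Q' → Set Q) (𝓕 : Set (Set Q)) : Set (Set Q') :=
  {F' | ∀ A : Set Q', rhoRel ρ A F' → ∃ F ∈ 𝓕, rhoRel ρ (⋃ q ∈ A, φ q) F}

theorem exists_mem_pullbackAcc_iff {Q Q' : Type*} (ρ : AccRho) (φ : Q' → Set Q)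
    (𝓕 : Set (Set Q)) (A : Set Q') :
    (∃ F' ∈ pullbackAcc ρ φ 𝓕, rhoRel ρ A F') ↔ ∃ F ∈ 𝓕, rhoRel ρ (⋃ q ∈ A, φ q) F := by
  constructor
  · rintro ⟨F', hF', h⟩
    exact hF' A h
  · rintro ⟨F, hF, h⟩
    cases ρ with
    | cap =>
      obtain ⟨q, hq, hqF⟩ := h
      obtain ⟨q', hq', hq⟩ := Set.mem_iUnion₂.1 hq
      refine ⟨{q'}, ?_, q', hq', rfl⟩
      rintro B ⟨_, hB, rfl⟩
      exact ⟨F, hF, q, Set.mem_biUnion hB hq, hqF⟩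
    | sub =>
      exact ⟨A, fun B hB => ⟨F, hF, (Set.biUnion_subset_biUnion_left hB).trans h⟩, subset_rfl⟩
    | eq =>
      refine ⟨A, ?_, rfl⟩
      rintro B rfl
      exact ⟨F, hF, h⟩

/-- An infinite concatenation of finite paths, infinitely many of them nonempty, is an infinite
path; `o n` is the time at which the `n`-th finite path starts. -/
theorem exists_concat_paths {α β : Type*} (R : β → α → α → Prop) (x : ℕ → α) (ps : ℕ → List β)
    (f : ℕ → ℕ → α) (hf0 : ∀ n, f n 0 = x n) (hfe : ∀ n, f n (ps n).length = x (n + 1))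
    (hf : ∀ n k (h : k < (ps n).length), R (ps n)[k] (f n k) (f n (k + 1)))
    (hinf : ∀ n, ∃ m, n ≤ m ∧ ps m ≠ []) :
    ∃ (s : ℕ → α) (d : ℕ → β) (o : ℕ → ℕ), o 0 = 0 ∧ Monotone o ∧ (∀ k, ∃ n, k < o n) ∧
      (∀ n, s (o n) = x n) ∧ (∀ i, R (d i) (s i) (s (i + 1))) ∧
      ∀ n, {p | p ∈ ps n} = {q | ∃ j, o n ≤ j ∧ j < o (n + 1) ∧ d j = q} := by
  classical
  let o : ℕ → ℕ := fun n => ∑ j ∈ Finset.range n, (ps j).length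
  have ho : ∀ n, o (n + 1) = o n + (ps n).length := fun n => Finset.sum_range_succ _ _
  have hmono : Monotone o := monotone_nat_of_le_succ fun n => by rw [ho]; omega
  have hunb : ∀ k, ∃ n, k < o (n + 1) := by
    intro k
    induction k with
    | zero =>
      obtain ⟨m, -, hm⟩ := hinf 0
      have := List.length_pos_iff.2 hm
      exact ⟨m, by rw [ho]; omega⟩
    | succ k ih =>
      obtain ⟨n, hn⟩ := ih
      obtain ⟨m, hnm, hm⟩ := hinf (n + 1)
      have := List.length_pos_iff.2 hm
      have := hmono hnm
      exact ⟨m, by rw [ho]; omega⟩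
  have hx : ∀ n m, n ≤ m → o m = o n → x m = x n := by
    intro n m hnm
    induction m, hnm using Nat.le_induction with
    | base => exact fun _ => rfl
    | succ m hnm ih =>
      intro h
      have h1 := hmono hnm
      have h2 := ho m
      have h3 : (ps m).length = 0 := by omega
      rw [← hfe, h3, hf0]
      exact ih (by omega)
  let idx : ℕ → ℕ := fun k => Nat.find (hunb k)
  have idx_lt : ∀ k, k < o (idx k + 1) := fun k => Nat.find_spec (hunb k)
  have idx_le : ∀ k, o (idx k) ≤ k := by
    intro k
    rcases h : idx k with _ | m
    · simp [o]
    · exact not_lt.1 (Nat.find_min (hunb k) (show m < idx k by omega))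
  have idx_eq : ∀ n k, o n ≤ k → k < o (n + 1) → idx k = n := by
    intro n k h1 h2
    have h3 : idx k ≤ n := Nat.find_min' _ h2
    by_contra hne
    have := hmono (show idx k + 1 ≤ n by omega)
    have := idx_lt k
    omega
  let s : ℕ → α := fun k => f (idx k) (k - o (idx k))
  have hlt : ∀ k, k - o (idx k) < (ps (idx k)).length := by
    intro k
    have h1 := idx_lt k
    have h2 := idx_le k
    rw [ho] at h1
    omega
  let d : ℕ → β := fun k => (ps (idx k))[k - o (idx k)]'(hlt k)
  have hso : ∀ n, s (o n) = x n := by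
    intro n
    have h1 := idx_lt (o n)
    have h2 := idx_le (o n)
    have h3 : n ≤ idx (o n) := by
      by_contra hne
      have := hmono (show idx (o n) + 1 ≤ n by omega)
      omega
    have h4 := hmono h3
    change f _ _ = _
    rw [show o n - o (idx (o n)) = 0 by omega, hf0]
    exact hx _ _ h3 (by omega)
  have hs : ∀ n k, o n ≤ k → k ≤ o (n + 1) → s k = f n (k - o n) := by
    intro n k h1 h2
    rcases h2.lt_or_eq with h2 | rfl
    · simp only [s, idx_eq n k h1 h2]
    · rw [hso, ho, Nat.add_sub_cancel_left, hfe]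
  have hd : ∀ n k (h1 : o n ≤ k) (h2 : k < o (n + 1)),
      d k = (ps n)[k - o n]'(by rw [ho] at h2; omega) := by
    intro n k h1 h2
    have := idx_eq n k h1 h2
    subst this
    rfl
  refine ⟨s, d, o, by simp [o], hmono, fun k => ⟨_, idx_lt k⟩, hso, fun i => ?_, fun n => ?_⟩
  · have h1 := idx_le i
    have h2 := idx_lt i
    rw [hs (idx i) (i + 1) (by omega) (by omega), show i + 1 - o (idx i) = i - o (idx i) + 1 by omega]
    exact hf _ _ _
  · ext p
    simp only [Set.mem_ofPred_eq]
    constructor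
    · intro hp
      obtain ⟨k, hk, rfl⟩ := List.getElem_of_mem hp
      refine ⟨o n + k, by omega, by rw [ho]; omega, ?_⟩
      rw [hd n _ (by omega) (by rw [ho]; omega)]
      simp
    · rintro ⟨j, h1, h2, rfl⟩
      rw [hd n j h1 h2]
      exact List.getElem_mem _

end OmegaFormal

namespace OmegaFormal.OmegaPSG

variable {T : Type} {G : OmegaPSG T}

/-- A terminal word that is a prefix of a form `w r v` is a prefix of `w` unless `r` is empty. -/
theorem terminal_prefix_split {N : Type*} {w₁ w : List T} {r : List N} {x v : List (N ⊕ T)}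
    (h : w₁.map Sum.inr ++ x = w.map Sum.inr ++ (r.map Sum.inl ++ v)) (hr : r ≠ [] ∨ v = []) :
    ∃ w₂, w = w₁ ++ w₂ ∧ x = w₂.map Sum.inr ++ (r.map Sum.inl ++ v) := by
  induction w₁ generalizing w with
  | nil => exact ⟨w, rfl, h⟩
  | cons a w₁ ih =>
    rcases w with _ | ⟨b, w⟩
    · rcases r with _ | ⟨A, r⟩ <;> simp_all
    · simp only [List.map_cons, List.cons_append, List.cons.injEq, Sum.inr.injEq] at h
      obtain ⟨w₂, rfl, hx⟩ := ih h.2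
      exact ⟨w₂, by simp [h.1], hx⟩

theorem lstep_iff {p : G.P} {x y : List (G.N ⊕ T)} :
    G.LStep p x y ↔ ∃ (w : List T) (v : List (G.N ⊕ T)),
      x = w.map Sum.inr ++ ((G.lhs p).map Sum.inl ++ v) ∧ y = w.map Sum.inr ++ (G.rhs p ++ v) := by
  constructor
  · rintro ⟨u, v, hu, hx, hy⟩
    obtain ⟨w, rfl⟩ : ∃ w : List T, w.map Sum.inr = u := by
      have hu' : u ∈ Set.range (List.map (Sum.inr : T → G.N ⊕ T)) := by
        rw [Set.range_list_map]
        intro s hs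
        obtain ⟨a, rfl⟩ := hu s hs
        exact ⟨a, rfl⟩
      exact hu'
    exact ⟨w, v, by simpa using hx, by simpa using hy⟩
  · rintro ⟨w, v, rfl, rfl⟩
    exact ⟨w.map Sum.inr, v, by simp, by simp, by simp⟩

variable (G) in
/-- `G.LDeriv x ps y`: the form `y` is obtained from `x` by leftmost steps with the successive
productions `ps`. -/
inductive LDeriv : List (G.N ⊕ T) → List G.P → List (G.N ⊕ T) → Prop
  | nil (x) : LDeriv x [] x
  | cons {x y z p ps} : G.LStep p x y → LDeriv y ps z → LDeriv x (p :: ps) z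

theorem LDeriv.trans {x y z : List (G.N ⊕ T)} {ps qs : List G.P} (h : G.LDeriv x ps y)
    (h' : G.LDeriv y qs z) : G.LDeriv x (ps ++ qs) z := by
  induction h with
  | nil => exact h'
  | cons hs _ ih => exact .cons hs (ih h')

theorem LStep.context {p : G.P} {x y : List (G.N ⊕ T)} (h : G.LStep p x y) (w : List T)
    (v : List (G.N ⊕ T)) : G.LStep p (w.map Sum.inr ++ (x ++ v)) (w.map Sum.inr ++ (y ++ v)) := by
  rw [lstep_iff] at h ⊢
  obtain ⟨w', v', rfl, rfl⟩ := h
  exact ⟨w ++ w', v' ++ v, by simp, by simp⟩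

theorem LDeriv.context {x y : List (G.N ⊕ T)} {ps : List G.P} (h : G.LDeriv x ps y) (w : List T)
    (v : List (G.N ⊕ T)) :
    G.LDeriv (w.map Sum.inr ++ (x ++ v)) ps (w.map Sum.inr ++ (y ++ v)) := by
  induction h with
  | nil => exact .nil _
  | cons hs _ ih => exact .cons (hs.context w v) ih

theorem LDeriv.append_right {x y : List (G.N ⊕ T)} {ps : List G.P} (h : G.LDeriv x ps y)
    (v : List (G.N ⊕ T)) : G.LDeriv (x ++ v) ps (y ++ v) := by
  simpa using h.context [] v

theorem LDeriv.strip_terminals {w : List T} {x z : List (G.N ⊕ T)} {ps : List G.P}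
    (h : G.LDeriv (w.map Sum.inr ++ x) ps z) :
    ∃ z', z = w.map Sum.inr ++ z' ∧ G.LDeriv x ps z' := by
  generalize hx : w.map Sum.inr ++ x = x₀ at h
  induction h generalizing x with
  | nil => exact ⟨x, hx.symm, .nil _⟩
  | @cons _ _ _ p _ hs _ ih =>
    obtain ⟨w', v, rfl, rfl⟩ := lstep_iff.1 hs
    obtain ⟨w₂, rfl, rfl⟩ := terminal_prefix_split hx (.inl (G.lhs_ne p))
    obtain ⟨z', rfl, h⟩ := ih (x := w₂.map Sum.inr ++ (G.rhs p ++ v)) (by simp)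
    exact ⟨z', rfl, .cons (lstep_iff.2 ⟨w₂, v, rfl, rfl⟩) h⟩

/-- The first of the productions `ps` has a left-hand side longer than `q`. -/
def FirstExceeds (q : List G.N) (ps : List G.P) : Prop :=
  ∀ p ∈ ps.head?, q.length < (G.lhs p).length

theorem firstExceeds_nil_left (ps : List G.P) : FirstExceeds ([] : List G.N) ps :=
  fun p _ => List.length_pos_iff.2 (G.lhs_ne p)

/-- A leftmost derivation from `a c` splits at the first step that involves `c`; just before that
step, `a` has been turned into a terminal word `w₁` followed by nonterminals `r₁`. -/
theorem LDeriv.split {a c : List (G.N ⊕ T)} {ps : List G.P} {w : List T} {r : List G.N}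
    (h : G.LDeriv (a ++ c) ps (w.map Sum.inr ++ r.map Sum.inl)) :
    ∃ ps₁ ps₂ w₁ w₂ r₁, ps = ps₁ ++ ps₂ ∧ w = w₁ ++ w₂ ∧
      G.LDeriv a ps₁ (w₁.map Sum.inr ++ r₁.map Sum.inl) ∧
      G.LDeriv (r₁.map Sum.inl ++ c) ps₂ (w₂.map Sum.inr ++ r.map Sum.inl) ∧
      FirstExceeds r₁ ps₂ ∧ (ps₂ = [] → r₁.length ≤ r.length) := by
  generalize hx : a ++ c = x at h
  generalize hz : w.map Sum.inr ++ r.map Sum.inl = z at h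
  induction h generalizing a with
  | nil x =>
    subst hz
    rcases List.append_eq_append_iff.1 hx with ⟨b, hb, rfl⟩ | ⟨b, rfl, hb⟩
    · obtain ⟨w₁, w₂, rfl, rfl, rfl⟩ := List.map_eq_append_iff.1 hb
      exact ⟨[], [], w₁, w₂, [], rfl, rfl, by simpa using .nil _, .nil _, by simp [FirstExceeds],
        by simp⟩
    · obtain ⟨r₁, r₂, rfl, rfl, rfl⟩ := List.map_eq_append_iff.1 hb
      exact ⟨[], [], w, [], r₁, rfl, by simp, .nil _, by simpa using .nil _, by simp [FirstExceeds],
        by simp⟩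
  | @cons _ _ _ p ps hs h ih =>
    obtain ⟨w', v, rfl, rfl⟩ := lstep_iff.1 hs
    have hcases : (∃ b, b ≠ [] ∧ w'.map Sum.inr ++ (G.lhs p).map Sum.inl = a ++ b ∧ c = b ++ v) ∨
        ∃ b, a = w'.map Sum.inr ++ (G.lhs p).map Sum.inl ++ b ∧ v = b ++ c := by
      rw [← List.append_assoc] at hx
      rcases List.append_eq_append_iff.1 hx with ⟨b, hb, hc⟩ | h
      · rcases eq_or_ne b [] with rfl | hne
        · exact .inr ⟨[], by simpa using hb.symm, by simpa using hc.symm⟩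
        · exact .inl ⟨b, hne, hb, hc⟩
      · exact .inr h
    rcases hcases with ⟨b, hne, hb, hc⟩ | ⟨b, rfl, rfl⟩
    · obtain ⟨w₁, r₁, hr₁, rfl⟩ : ∃ (w₁ : List T) (r₁ : List G.N),
          FirstExceeds r₁ (p :: ps) ∧ a = w₁.map Sum.inr ++ r₁.map Sum.inl := by
        rcases List.append_eq_append_iff.1 hb with ⟨b', rfl, hb'⟩ | ⟨b', hb', -⟩
        · obtain ⟨r₁, r₂, hl, rfl, rfl⟩ := List.map_eq_append_iff.1 hb'
          refine ⟨w', r₁, ?_, rfl⟩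
          have := List.length_pos_iff.2 (fun h => hne (by simp [h]) : r₂ ≠ [])
          simp only [FirstExceeds, List.head?_cons, Option.mem_def, Option.some.injEq]
          rintro _ rfl
          simp only [hl, List.length_append]
          omega
        · obtain ⟨w₁, w₂, rfl, rfl, rfl⟩ := List.map_eq_append_iff.1 hb'
          exact ⟨w₁, [], firstExceeds_nil_left _, by simp⟩
      have h' := LDeriv.cons hs h
      rw [← hx, List.append_assoc] at h'
      obtain ⟨z', hz', h'⟩ := h'.strip_terminals
      obtain ⟨w₂, rfl, rfl⟩ := terminal_prefix_split (v := []) (r := r) (w := w)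
        (by rw [← hz', ← hz]; simp) (.inr rfl)
      exact ⟨[], p :: ps, w₁, w₂, r₁, rfl, rfl, .nil _, by simpa using h', hr₁, by simp⟩
    · obtain ⟨ps₁, ps₂, w₁, w₂, r₁, rfl, hw, h₁, h₂⟩ :=
        ih (a := w'.map Sum.inr ++ (G.rhs p ++ b)) (by simp) hz
      refine ⟨p :: ps₁, ps₂, w₁, w₂, r₁, rfl, hw, .cons ?_ h₁, h₂⟩
      exact lstep_iff.2 ⟨w', b, by simp, rfl⟩

end OmegaFormal.OmegaPSG

namespace OmegaFormal.OmegaPSG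

variable {T : Type} {G : OmegaPSG T}

theorem termPrefix_append {N : Type*} (w : List T) (x : List (N ⊕ T)) :
    termPrefix (w.map Sum.inr ++ x) = w ++ termPrefix x := by
  induction w with
  | nil => rfl
  | cons a w ih => simp [termPrefix, ih]

theorem LStep.termPrefix_prefix {p : G.P} {x y : List (G.N ⊕ T)} (h : G.LStep p x y) :
    termPrefix x <+: termPrefix y := by
  obtain ⟨w, v, rfl, rfl⟩ := lstep_iff.1 h
  rw [termPrefix_append, termPrefix_append]
  obtain ⟨A, l, hl⟩ := List.exists_cons_of_ne_nil (G.lhs_ne p)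
  simp [hl, termPrefix]

theorem LDeriv.exists_path {x y : List (G.N ⊕ T)} {ps : List G.P} (h : G.LDeriv x ps y) :
    ∃ f : ℕ → List (G.N ⊕ T), f 0 = x ∧ f ps.length = y ∧
      ∀ k (hk : k < ps.length), G.LStep ps[k] (f k) (f (k + 1)) := by
  induction h with
  | nil x => exact ⟨fun _ => x, rfl, rfl, by simp⟩
  | @cons x y z p ps hs _ ih =>
    obtain ⟨f, h0, he, hf⟩ := ih
    refine ⟨fun k => Nat.casesOn k x f, rfl, he, fun k hk => ?_⟩
    cases k with
    | zero => simpa [h0] using hs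
    | succ k => simpa using hf k (by simpa using hk)

theorem matchesPrefix_of_prefix {l l' : List T} {u : ℕ → T} (h : MatchesPrefix l' u)
    (hl : l <+: l') : MatchesPrefix l u := by
  intro k hk
  rw [← h k (hk.trans_le hl.length_le)]
  simp [hl.getElem hk]

/-- An ω-word is generated by `G` if it is spelled by an infinite sequence of finite leftmost
derivations whose sequence of production sets is accepting. -/
theorem mem_lang_of_blocks {σ : AccSigma} {ρ : AccRho} {u : ℕ → T} (x : ℕ → List (G.N ⊕ T))
    (w : ℕ → List T) (ps : ℕ → List G.P) (h0 : x 0 = [Sum.inl G.start])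
    (hw : ∀ n, w n <+: termPrefix (x n)) (hx : ∀ n, G.LDeriv (x n) (ps n) (x (n + 1)))
    (hunb : ∀ k, ∃ n, k ≤ (w n).length) (hu : ∀ n, MatchesPrefix (w n) u)
    (hacc : ∃ F ∈ G.acc, rhoRel ρ (sigmaSetSeq σ fun n => {p | p ∈ ps n}) F) :
    u ∈ G.Lang σ ρ DerivMode.l := by
  choose f hf0 hfe hf using fun n => (hx n).exists_path
  have hxmono : ∀ n m, n ≤ m → termPrefix (x n) <+: termPrefix (x m) := by
    intro n m hnm
    induction m, hnm using Nat.le_induction with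
    | base => exact List.prefix_refl _
    | succ m _ ih =>
      refine ih.trans ?_
      have key : ∀ k ≤ (ps m).length, termPrefix (x m) <+: termPrefix (f m k) := by
        intro k
        induction k with
        | zero => intro _; rw [hf0]
        | succ k ihk => exact fun hk => (ihk (by omega)).trans (hf m k hk).termPrefix_prefix
      simpa [hfe] using key _ le_rfl
  have hinf : ∀ n, ∃ m, n ≤ m ∧ ps m ≠ [] := by
    intro n
    by_contra! hcon
    have hconst : ∀ m, n ≤ m → x m = x n := by
      intro m hnm
      induction m, hnm using Nat.le_induction with
      | base => rfl
      | succ m hm ih =>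
        have h1 := hfe m
        rw [hcon m hm, List.length_nil, hf0] at h1
        rw [← h1, ih]
    obtain ⟨m, hm⟩ := hunb ((termPrefix (x n)).length + 1)
    have h1 := (hw m).length_le
    rcases le_total n m with h | h
    · rw [hconst m h] at h1
      omega
    · have := (hxmono m n h).length_le
      omega
  obtain ⟨s, d, o, ho0, homono, hounb, hso, hs, hd⟩ :=
    exists_concat_paths G.LStep x ps f hf0 hfe hf hinf
  have hsmono : ∀ i j, i ≤ j → termPrefix (s i) <+: termPrefix (s j) := by
    intro i j hij
    induction j, hij using Nat.le_induction with
    | base => exact List.prefix_refl _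
    | succ j _ ih => exact ih.trans (hs j).termPrefix_prefix
  refine ⟨s, d, ?_, hs, fun k => ?_, fun i => ?_, ?_⟩
  · rw [← h0, ← hso 0, ho0]
  · obtain ⟨n, hn⟩ := hunb k
    exact ⟨o n, hn.trans (by rw [hso]; exact (hw n).length_le)⟩
  · obtain ⟨n, hn⟩ := hunb (termPrefix (s i)).length
    refine matchesPrefix_of_prefix (hu n) (List.prefix_of_prefix_length_le
      (hsmono i (max i (o n)) (le_max_left _ _)) ?_ hn)
    refine List.IsPrefix.trans ?_ (hsmono (o n) _ (le_max_right _ _))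
    rw [hso]
    exact hw n
  · simp only [hd] at hacc
    rwa [sigmaSetSeq_blocks σ d o ho0 homono hounb] at hacc

end OmegaFormal.OmegaPSG

namespace OmegaFormal.OmegaPSG

variable {T : Type} (G : OmegaPSG T)

/-- A bound on the lengths of both sides of all productions. -/
def bound : ℕ :=
  haveI := G.fintypeP
  1 + ∑ p : G.P, ((G.lhs p).length + (G.rhs p).length)

theorem length_le_bound (p : G.P) :
    (G.lhs p).length ≤ G.bound ∧ (G.rhs p).length ≤ G.bound := by
  let _ := G.fintypeP
  have := Finset.single_le_sum (f := fun p => (G.lhs p).length + (G.rhs p).length)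
    (fun _ _ => Nat.zero_le _) (Finset.mem_univ p)
  simp only [bound] at this ⊢
  omega

/-- Bounded words of nonterminals, read as the part of the next left-hand side already seen. -/
abbrev Buffer : Type := {q : List G.N // q.length ≤ G.bound}

/-- The empty buffer. -/
abbrev emptyBuffer : G.Buffer := ⟨[], Nat.zero_le _⟩

/-- The nonterminals `(q, Z, c)` of the ε-free grammar: the symbol `Z` preceded by the buffer `q`.
If `c = some (m, E, r)`, then `q Z` is to be rewritten to a nonempty terminal word followed by `m`,
and afterwards some erased symbols turn `m` into `r`, with production set `E`.
If `c = none`, then the rewriting of `q Z` never ends. -/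
abbrev Item : Type := G.Buffer × (G.N ⊕ T) × Option (G.Buffer × Set G.P × G.Buffer)

variable {G}

/-- Leftmost steps with production set `E` turn `q e` into `r`. -/
def Erases (q : List G.N) (e : List (G.N ⊕ T)) (r : List G.N) (E : Set G.P) : Prop :=
  ∃ ps, G.LDeriv (q.map Sum.inl ++ e) ps (r.map Sum.inl) ∧ {p | p ∈ ps} = E

theorem Erases.refl (q : List G.N) : Erases q ([] : List (G.N ⊕ T)) q ∅ :=
  ⟨[], by simpa using .nil _, by simp⟩

theorem Erases.trans {q m r : List G.N} {e e' : List (G.N ⊕ T)} {E E' : Set G.P}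
    (h : Erases q e m E) (h' : Erases m e' r E') : Erases q (e ++ e') r (E ∪ E') := by
  obtain ⟨ps, h, rfl⟩ := h
  obtain ⟨ps', h', rfl⟩ := h'
  refine ⟨ps ++ ps', ?_, by ext; simp⟩
  have := (h.append_right e').trans h'
  rwa [List.append_assoc] at this

/-- `Continues c' e c`: the erased symbols `e` followed by the continuation `c` amount to the
continuation `c'`. -/
inductive Continues : Option (G.Buffer × Set G.P × G.Buffer) → List (G.N ⊕ T) →
    Option (G.Buffer × Set G.P × G.Buffer) → Prop
  | endless (e) : Continues none e none
  | erase {m mid r : G.Buffer} {e E R} : Erases m.1 e mid.1 E →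
      Continues (some (m, E ∪ R, r)) e (some (mid, R, r))

/-- `Covers c q x y`: the items `y` describe the word `x` preceded by the buffer `q` and followed
by the continuation `c`. -/
inductive Covers (c : Option (G.Buffer × Set G.P × G.Buffer)) :
    G.Buffer → List (G.N ⊕ T) → List G.Item → Prop
  | last {q Z e c'} : Continues c' e c → Covers c q (Z :: e) [(q, Z, c')]
  | cons {q m r : G.Buffer} {Z e E x y} : Erases m.1 e r.1 E → Covers c r x y →
      Covers c q (Z :: (e ++ x)) ((q, Z, some (m, E, r)) :: y)

theorem Continues.append {m r : G.Buffer} {E : Set G.P} {e e' : List (G.N ⊕ T)}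
    {c' : Option (G.Buffer × Set G.P × G.Buffer)} (h : Continues c' e (some (m, E, r)))
    (h' : Erases m.1 e' r.1 E) : ∃ m' E', c' = some (m', E', r) ∧ Erases m'.1 (e ++ e') r.1 E' := by
  cases h with
  | erase h => exact ⟨_, _, rfl, h.trans h'⟩

theorem Covers.append {c : Option (G.Buffer × Set G.P × G.Buffer)} {q m r : G.Buffer} {E : Set G.P}
    {x e x' : List (G.N ⊕ T)} {y y' : List G.Item} (h : Covers (some (m, E, r)) q x y)
    (he : Erases m.1 e r.1 E) (h' : Covers c r x' y') : Covers c q (x ++ (e ++ x')) (y ++ y') := by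
  induction h with
  | last h =>
    obtain ⟨m', E', rfl, h₂⟩ := h.append he
    simpa using Covers.cons h₂ h'
  | cons h _ ih => simpa using Covers.cons h ih

theorem Covers.append_none {q : G.Buffer} {x : List (G.N ⊕ T)} {y : List G.Item}
    (h : Covers none q x y) (e : List (G.N ⊕ T)) : Covers none q (x ++ e) y := by
  induction h with
  | last h =>
    cases h
    exact .last (.endless _)
  | cons h _ ih => simpa using Covers.cons h ih

theorem Covers.ne_nil {c : Option (G.Buffer × Set G.P × G.Buffer)} {q : G.Buffer}
    {x : List (G.N ⊕ T)} {y : List G.Item} (h : Covers c q x y) : y ≠ [] := by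
  cases h <;> simp

theorem Covers.length_le {c : Option (G.Buffer × Set G.P × G.Buffer)} {q : G.Buffer}
    {x : List (G.N ⊕ T)} {y : List G.Item} (h : Covers c q x y) : y.length ≤ x.length := by
  induction h with
  | last => simp
  | cons _ _ ih =>
    simp only [List.length_cons, List.length_append]
    omega

/-- The productions of the ε-free grammar, labelled by sets of productions of `G`. -/
inductive Rule : G.Item → Set G.P → List (G.Item ⊕ T) → Prop
  | emit (a : T) (R r) :
      Rule (G.emptyBuffer, Sum.inr a, some (G.emptyBuffer, R, r)) R [Sum.inr a]
  | expand {p : G.P} {q q₁ : G.Buffer} {A c e z E y} : G.lhs p = q.1 ++ [A] → G.rhs p = e ++ z →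
      Erases [] e q₁.1 E → Covers c q₁ z y → Rule (q, Sum.inl A, c) (insert p E) (y.map Sum.inl)

theorem Rule.rhs_ne_nil {A : G.Item} {E : Set G.P} {x : List (G.Item ⊕ T)} (h : Rule A E x) :
    x ≠ [] := by
  cases h with
  | emit => simp
  | expand _ _ _ h => simpa using h.ne_nil

theorem Rule.length_le {A : G.Item} {E : Set G.P} {x : List (G.Item ⊕ T)} (h : Rule A E x) :
    x.length ≤ G.bound := by
  cases h with
  | emit => simp [bound]
  | @expand p _ _ _ _ _ _ _ _ _ hp _ h =>
    have h1 := h.length_le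
    have h2 := (G.length_le_bound p).2
    simp only [hp, List.length_append, List.length_map] at h2 ⊢
    omega

variable (G) in
/-- The named productions of the ε-free grammar. -/
abbrev RuleName : Type :=
  {t : G.Item × Set G.P × {l : List (G.Item ⊕ T) // l.length ≤ G.bound} // Rule t.1 t.2.1 t.2.2.1}

/-- The production set of `G` simulated by a production of the ε-free grammar. -/
abbrev RuleName.label (t : G.RuleName) : Set G.P := t.1.2.1

variable (G) in
instance finite_buffer : Finite G.Buffer :=
  haveI := G.fintypeN
  (List.finite_length_le G.N G.bound).to_subtype

variable (G) in
instance finite_item [Finite T] : Finite G.Item :=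
  haveI := G.fintypeN
  haveI := G.fintypeP
  inferInstance

variable (G) in
instance finite_ruleName [Finite T] : Finite G.RuleName :=
  haveI := G.fintypeP
  haveI : Finite {l : List (G.Item ⊕ T) // l.length ≤ G.bound} :=
    (List.finite_length_le (G.Item ⊕ T) G.bound).to_subtype
  inferInstance

variable (G) in
/-- An ε-free context-free ω-grammar generating the same ω-words as `G` by leftmost derivations. -/
noncomputable abbrev epsFree [Finite T] (ρ : AccRho) : OmegaPSG T where
  N := G.Item
  fintypeN := Fintype.ofFinite _
  P := G.RuleName
  fintypeP := Fintype.ofFinite _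
  lhs t := [t.1.1]
  lhs_ne _ := by simp
  rhs t := t.1.2.2.1
  start := (G.emptyBuffer, Sum.inl G.start, none)
  acc := pullbackAcc ρ RuleName.label G.acc

/-- A form `x'` of the ε-free grammar describes the form `x` of `G`. -/
def Simulates (x' : List (G.Item ⊕ T)) (x : List (G.N ⊕ T)) : Prop :=
  ∃ (w : List T) (y : List G.Item) (q : G.Buffer) (z : List (G.N ⊕ T)),
    x' = w.map Sum.inr ++ y.map Sum.inl ∧ x = w.map Sum.inr ++ (q.1.map Sum.inl ++ z) ∧
    Covers none q z y

theorem Simulates.termPrefix_prefix {x' : List (G.Item ⊕ T)} {x : List (G.N ⊕ T)}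
    (h : Simulates x' x) : termPrefix x' <+: termPrefix x := by
  obtain ⟨w, y, q, z, rfl, rfl, h⟩ := h
  obtain ⟨A, y, rfl⟩ := List.exists_cons_of_ne_nil h.ne_nil
  simp [termPrefix_append, termPrefix]

theorem Simulates.step [Finite T] {ρ : AccRho} {x' x'' : List (G.Item ⊕ T)} {x : List (G.N ⊕ T)}
    (h : Simulates x' x) {t : G.RuleName} (ht : (G.epsFree ρ).LStep t x' x'') :
    ∃ ps x₂, G.LDeriv x ps x₂ ∧ {p | p ∈ ps} = t.label ∧ Simulates x'' x₂ := by
  obtain ⟨w, y, q, z, rfl, rfl, h⟩ := h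
  obtain ⟨⟨A, E, l, hl⟩, hr⟩ := t
  obtain ⟨w', v, hx, rfl⟩ := lstep_iff.1 ht
  obtain ⟨B, y, rfl⟩ := List.exists_cons_of_ne_nil h.ne_nil
  obtain ⟨w₂, rfl, hy⟩ := terminal_prefix_split hx (.inl (by simp))
  obtain rfl : w₂ = [] := by
    cases w₂ <;> simp_all
  simp only [List.map_cons, List.map_nil, List.nil_append, List.cons_append, List.cons.injEq,
    Sum.inl.injEq] at hy
  obtain ⟨rfl, rfl⟩ := hy
  clear hx
  simp only at hr
  cases hr with
  | emit a R r =>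
    cases h with
    | last h => cases h
    | @cons _ _ _ _ e _ x _ he hc =>
      obtain ⟨ps, he, rfl⟩ := he
      refine ⟨ps, _, (he.append_right x).context (w ++ [a]) [] |> fun h => ?_, rfl,
        w ++ [a], y, r, x, by simp, rfl, hc⟩
      simpa using h
  | @expand p q' q₁ A c e x E y₁ hp hrhs he hcov =>
    obtain ⟨ps, he, rfl⟩ := he
    obtain ⟨rfl, z', rfl, hcov'⟩ : q = q' ∧ ∃ z', z = Sum.inl A :: z' ∧
        Covers none q₁ (x ++ z') (y₁ ++ y) := by
      cases h with
      | last h =>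
        cases h
        exact ⟨rfl, _, rfl, by simpa using hcov.append_none _⟩
      | cons h h' => exact ⟨rfl, _, rfl, hcov.append h h'⟩
    refine ⟨p :: ps, _, .cons (lstep_iff.2 ⟨w, z', by simp [hp], rfl⟩) ?_,
      by ext; simp [RuleName.label], w, y₁ ++ y, q₁, x ++ z', by simp, rfl, hcov'⟩
    simpa [hrhs] using he.context w (x ++ z')

end OmegaFormal.OmegaPSG

namespace OmegaFormal.OmegaPSG

variable {T : Type} {G : OmegaPSG T} [Finite T] {σ : AccSigma} {ρ : AccRho}

theorem exists_mem_epsFree_acc_iff (D : ℕ → Set G.RuleName) :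
    (∃ F ∈ (G.epsFree ρ).acc, rhoRel ρ (sigmaSetSeq σ D) F) ↔
      ∃ F ∈ G.acc, rhoRel ρ (sigmaSetSeq σ fun n => ⋃ t ∈ D n, t.label) F := by
  rw [exists_mem_pullbackAcc_iff, sigmaSetSeq_biUnion]

theorem epsFree_lang_subset : (G.epsFree ρ).Lang σ ρ DerivMode.l ⊆ G.Lang σ ρ DerivMode.l := by
  rintro u ⟨s, d, h0, hs, hunb, hu, hacc⟩
  choose ps x₂ hx hps hsim using fun (n : ℕ) (x : {x // Simulates (s n) x}) => x.2.step (hs n)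
  let f : (n : ℕ) → {x // Simulates (s n) x} := fun n => Nat.rec
    ⟨[Sum.inl G.start], [], [(G.emptyBuffer, Sum.inl G.start, none)], G.emptyBuffer,
      [Sum.inl G.start], h0, rfl, .last (.endless _)⟩
    (fun n x => ⟨x₂ n x, hsim n x⟩) n
  refine mem_lang_of_blocks (fun n => (f n).1) (fun n => termPrefix (s n)) (fun n => ps n (f n))
    rfl (fun n => (f n).2.termPrefix_prefix) (fun n => hx n (f n)) hunb hu ?_
  rw [IsAccepting, ← sigmaSetSeq_singleton, exists_mem_epsFree_acc_iff] at hacc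
  simpa [hps] using hacc

end OmegaFormal.OmegaPSG

namespace OmegaFormal.OmegaPSG

variable {T : Type} {G : OmegaPSG T}

/-- The form of the first step of a leftmost derivation from `q α` that produces a terminal,
provided that step involves `α`. -/
theorem LDeriv.head_cases {q r : List G.N} {α : List (G.N ⊕ T)} {ps : List G.P} {w : List T}
    (h : G.LDeriv (q.map Sum.inl ++ α) ps (w.map Sum.inr ++ r.map Sum.inl))
    (hq : FirstExceeds q ps) (hw : w ≠ []) :
    (∃ a α', q = [] ∧ α = Sum.inr a :: α') ∨
      ∃ A α' p ps₂, α = Sum.inl A :: α' ∧ ps = p :: ps₂ ∧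
        (G.lhs p = q ++ [A] ∧
            G.LDeriv (G.rhs p ++ α') ps₂ (w.map Sum.inr ++ r.map Sum.inl) ∨
          q.length + 1 < (G.lhs p).length) := by
  obtain ⟨b, w, rfl⟩ := List.exists_cons_of_ne_nil hw
  generalize hx : q.map Sum.inl ++ α = x at h
  generalize hz : (b :: w).map Sum.inr ++ r.map Sum.inl = z at h
  cases h with
  | nil =>
    subst hz
    rcases q with _ | ⟨_, q⟩
    · exact .inl ⟨b, _, rfl, hx⟩
    · simp at hx
  | @cons _ _ _ p ps hs h =>
    replace hq : q.length < (G.lhs p).length := hq p rfl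
    obtain ⟨w', v, rfl, rfl⟩ := lstep_iff.1 hs
    rcases w' with _ | ⟨a, w'⟩
    · right
      simp only [List.map_nil, List.nil_append] at hx h
      rcases List.append_eq_append_iff.1 hx with ⟨l, hl, rfl⟩ | ⟨l, hl, -⟩
      · obtain ⟨q', l', hlhs, hq', rfl⟩ := List.map_eq_append_iff.1 hl
        obtain rfl := Sum.inl_injective.list_map hq'
        rw [hlhs] at hq
        rcases l' with _ | ⟨A, _ | ⟨B, l'⟩⟩
        · simp at hq
        · exact ⟨A, v, p, ps, rfl, rfl, .inl ⟨hlhs, h⟩⟩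
        · exact ⟨A, _, p, ps, rfl, rfl, .inr (by simp [hlhs])⟩
      · have := congrArg List.length hl
        simp only [List.length_map, List.length_append] at this
        omega
    · rcases q with _ | ⟨_, q⟩
      · exact .inl ⟨a, _, rfl, hx⟩
      · simp at hx

/-- The union of the labels of a list of productions of the ε-free grammar. -/
def labels (ts : List G.RuleName) : Set G.P := {p | ∃ t ∈ ts, p ∈ t.label}

variable [Finite T] {ρ : AccRho}

variable (ρ) in
/-- The ε-free grammar derives `z` from `x` by leftmost steps with productions labelled by sets
whose union is `L`. -/
def Generates (x : List (G.Item ⊕ T)) (L : Set G.P) (z : List (G.Item ⊕ T)) : Prop :=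
  ∃ ts, (G.epsFree ρ).LDeriv x ts z ∧ labels ts = L

theorem Generates.refl (x : List (G.Item ⊕ T)) : Generates ρ x ∅ x :=
  ⟨[], .nil _, by simp [labels]⟩

theorem Generates.append {x x' z : List (G.Item ⊕ T)} {w : List T} {L L' : Set G.P}
    (h : Generates ρ x L (w.map Sum.inr)) (h' : Generates ρ x' L' z) :
    Generates ρ (x ++ x') (L ∪ L') (w.map Sum.inr ++ z) := by
  obtain ⟨ts, h, rfl⟩ := h
  obtain ⟨ts', h', rfl⟩ := h'
  refine ⟨ts ++ ts', (h.append_right x').trans (by simpa using h'.context w []), ?_⟩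
  ext
  simp [labels, or_and_right, exists_or]

theorem Rule.generates {A : G.Item} {E L : Set G.P} {x z : List (G.Item ⊕ T)} (h : Rule A E x)
    (h' : Generates ρ x L z) : Generates ρ [Sum.inl A] (E ∪ L) z := by
  obtain ⟨ts, h', rfl⟩ := h'
  refine ⟨⟨(A, E, ⟨x, h.length_le⟩), h⟩ :: ts, .cons (lstep_iff.2 ⟨[], [], rfl, by simp⟩) h', ?_⟩
  ext
  simp [labels, RuleName.label]

theorem generates_emit (a : T) (R : Set G.P) (r : G.Buffer) :
    Generates ρ [Sum.inl (G.emptyBuffer, Sum.inr a, some (G.emptyBuffer, R, r))] R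
      [Sum.inr a] := by
  simpa using (Rule.emit a R r).generates (ρ := ρ) (.refl _)

/-- A finite leftmost derivation producing a nonempty terminal word is simulated by the ε-free
grammar, once the symbols `e` that are erased before the first terminal are removed. -/
theorem LDeriv.exists_generates {ps : List G.P} {α : List (G.N ⊕ T)} {q r : G.Buffer} {w : List T}
    (h : G.LDeriv (q.1.map Sum.inl ++ α) ps (w.map Sum.inr ++ r.1.map Sum.inl))
    (hq : FirstExceeds q.1 ps) (hw : w ≠ []) (R : Set G.P) (r₂ : G.Buffer) :
    ∃ (e z : List (G.N ⊕ T)) (q₁ : G.Buffer) (E L : Set G.P) (y : List G.Item),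
      α = e ++ z ∧ Erases q.1 e q₁.1 E ∧ Covers (some (r, R, r₂)) q₁ z y ∧
      Generates ρ (y.map Sum.inl) L (w.map Sum.inr) ∧ E ∪ L = {p | p ∈ ps} ∪ R := by
  rcases h.head_cases hq hw with ⟨a, α', hq', hα⟩ | ⟨A, α', p, ps₂, hα, hps, hp⟩
  · rw [hα] at h
    obtain rfl : q = G.emptyBuffer := Subtype.ext hq'
    obtain ⟨z', hz', h⟩ := LDeriv.strip_terminals (w := [a]) (x := α') h
    obtain ⟨w, rfl, rfl⟩ := terminal_prefix_split (v := []) (r := r.1) (w := w) (w₁ := [a])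
      (by rw [← hz']; simp) (.inr rfl)
    rcases eq_or_ne w [] with rfl | hw'
    · refine ⟨[], _, G.emptyBuffer, ∅, {p | p ∈ ps} ∪ R, _, hα, .refl _,
        .last (.erase ⟨ps, by simpa using h, rfl⟩), generates_emit a _ r₂, by simp⟩
    · obtain ⟨e, z, q₁, E, L, y, rfl, he, hc, hg, hL⟩ := LDeriv.exists_generates
        (q := G.emptyBuffer) (by simpa using h) (firstExceeds_nil_left _) hw' R r₂
      exact ⟨[], _, G.emptyBuffer, ∅, E ∪ L, _, hα, .refl _, .cons he hc,
        by simpa using (generates_emit a E q₁).append (w := [a]) hg, by simpa using hL⟩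
  · rw [hα, hps] at h
    rw [hps] at hq
    have hqA : (q.1 ++ [A]).length ≤ G.bound := by
      have h1 := (G.length_le_bound p).1
      have h2 := hq p rfl
      simp only [List.length_append, List.length_singleton]
      omega
    rcases hp with ⟨hlhs, h'⟩ | hlt
    · obtain ⟨ps₃, ps₄, w₁, w₂, r₁, rfl, rfl, h₃, h₄, hex, hend⟩ := h'.split
      have hr₁ : r₁.length ≤ G.bound := by
        rcases ps₄ with _ | ⟨p', ps₄⟩
        · exact (hend rfl).trans r.2
        · exact (hex p' rfl).le.trans (G.length_le_bound p').1
      rcases eq_or_ne w₁ [] with rfl | hw₁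
      · obtain ⟨e, z, q₁, E, L, y, rfl, he, hc, hg, hL⟩ := LDeriv.exists_generates
          (q := ⟨r₁, hr₁⟩) h₄ hex (by simpa using hw) R r₂
        have hA : Erases q.1 [Sum.inl A] r₁ {p' | p' ∈ p :: ps₃} :=
          ⟨_, .cons (lstep_iff.2 ⟨[], [], by simp [hlhs], rfl⟩) (by simpa using h₃), rfl⟩
        refine ⟨Sum.inl A :: e, z, q₁, _, L, y, hα, hA.trans he, hc, hg, ?_⟩
        rw [Set.union_assoc, hL, hps]
        ext
        simp [or_assoc]
      · rcases eq_or_ne w₂ [] with rfl | hw₂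
        · obtain ⟨e, z, q₁, E, L, y, hrhs, he, hc, hg, hL⟩ := LDeriv.exists_generates
            (q := G.emptyBuffer) (r := ⟨r₁, hr₁⟩) h₃ (firstExceeds_nil_left _) hw₁
            ({p' | p' ∈ ps₄} ∪ R) r₂
          refine ⟨[], _, q, ∅, _, _, hα, .refl _, .last (.erase ⟨ps₄, h₄, rfl⟩),
            by simpa using (Rule.expand hlhs hrhs he hc).generates hg, ?_⟩
          rw [Set.insert_union, hL, hps]
          ext
          simp [or_assoc]
        · obtain ⟨e', z', q₂, E', L', y', rfl, he', hc', hg', hL'⟩ := LDeriv.exists_generates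
            (q := ⟨r₁, hr₁⟩) h₄ hex hw₂ R r₂
          obtain ⟨e, z, q₁, E, L, y, hrhs, he, hc, hg, hL⟩ := LDeriv.exists_generates
            (q := G.emptyBuffer) (r := ⟨r₁, hr₁⟩) h₃ (firstExceeds_nil_left _) hw₁ E' q₂
          refine ⟨[], _, q, ∅, _, _, hα, .refl _, .cons he' hc',
            by simpa using ((Rule.expand hlhs hrhs he hc).generates hg).append hg', ?_⟩
          rw [Set.insert_union, hL, Set.insert_union, Set.union_assoc, hL', hps]
          ext
          simp [or_assoc]
    · obtain ⟨e, z, q₁, E, L, y, rfl, he, hc, hg, hL⟩ := LDeriv.exists_generates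
        (q := ⟨q.1 ++ [A], hqA⟩) (α := α') (by simpa using h)
        (fun p' hp' => by
          obtain rfl : p = p' := by simpa using hp'
          simpa using hlt) hw R r₂
      obtain ⟨ps', he, hE⟩ := he
      exact ⟨Sum.inl A :: e, z, q₁, E, L, y, hα, ⟨ps', by simpa using he, hE⟩, hc, hg, hps ▸ hL⟩
termination_by (ps.length, α.length)
decreasing_by
  · rw [hα]
    exact .right _ (by simp)
  · rw [hps]
    exact .left _ _ (by simp)
  · rw [hps]
    exact .left _ _ (by simp)
  · rw [hps]
    exact .left _ _ (by simp)
  · rw [hps]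
    exact .left _ _ (by simp)
  · rw [hα, hps]
    exact .right _ (by simp)

end OmegaFormal.OmegaPSG

namespace OmegaFormal

/-- A sequence of positions such that `t (n + 1)` is the first position after `t n` at which the
values of `b` after `t n` attain their minimum. -/
theorem exists_spine (b : ℕ → ℕ) (hb : b 0 = 0) :
    ∃ t : ℕ → ℕ, t 0 = 0 ∧ StrictMono t ∧ (∀ n, b (t n) ≤ b (t (n + 1))) ∧
      ∀ n j, t n < j → j < t (n + 1) → b (t (n + 1)) < b j := by
  have hnext : ∀ i, ∃ k, i < k ∧ (∀ j, i < j → b k ≤ b j) ∧ ∀ j, i < j → j < k → b k < b j := by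
    intro i
    have hex : ∃ k, i < k ∧ ∀ j, i < j → b k ≤ b j := by
      obtain ⟨k, hk, hmin⟩ := exists_minimalFor_of_wellFoundedLT (i < ·) b ⟨i + 1, i.lt_succ_self⟩
      exact ⟨k, hk, fun j hj => (le_total (b k) (b j)).elim id (hmin hj)⟩
    classical
    refine ⟨Nat.find hex, (Nat.find_spec hex).1, (Nat.find_spec hex).2, fun j hj hlt => ?_⟩
    by_contra! hle
    exact Nat.find_min hex hlt ⟨hj, fun k hk => hle.trans ((Nat.find_spec hex).2 k hk)⟩
  choose next hlt hle hfirst using hnext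
  refine ⟨fun n => next^[n] 0, rfl, strictMono_nat_of_lt_succ fun n => ?_, fun n => ?_,
    fun n j => ?_⟩
  · simpa only [Function.iterate_succ_apply'] using hlt _
  · cases n with
    | zero => simp [hb]
    | succ n =>
      simp only [Function.iterate_succ_apply']
      exact hle _ _ ((hlt _).trans (hlt _))
  · simpa only [Function.iterate_succ_apply'] using hfirst _ j

namespace OmegaPSG

variable {T : Type} {G : OmegaPSG T} {s : ℕ → List (G.N ⊕ T)} {d : ℕ → G.P} {w : ℕ → List T}
  {v : ℕ → List (G.N ⊕ T)}

/-- Steps that leave the suffix `c` untouched form a derivation from the word before it. -/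
theorem lderiv_of_length_le
    (hs : ∀ i, s i = (w i).map Sum.inr ++ ((G.lhs (d i)).map Sum.inl ++ v i))
    (hs' : ∀ i, s (i + 1) = (w i).map Sum.inr ++ (G.rhs (d i) ++ v i)) {c : List (G.N ⊕ T)}
    {w₀ : List T} (k : ℕ) {i : ℕ} {a : List (G.N ⊕ T)} (h : s i = w₀.map Sum.inr ++ (a ++ c))
    (hc : ∀ j, i ≤ j → j < i + k → c.length ≤ (v j).length) :
    ∃ a', s (i + k) = w₀.map Sum.inr ++ (a' ++ c) ∧
      G.LDeriv a ((List.range' i k).map d) a' := by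
  induction k generalizing i a with
  | zero => exact ⟨a, h, .nil _⟩
  | succ k ih =>
    have heq := h.symm.trans (hs i)
    obtain ⟨b, hb⟩ : c <:+ v i := List.suffix_of_suffix_length_le (l₃ := s i)
      ⟨w₀.map Sum.inr ++ a, by simp [h]⟩
      ⟨(w i).map Sum.inr ++ (G.lhs (d i)).map Sum.inl, by simp [hs i]⟩ (hc i le_rfl (by omega))
    obtain ⟨w₂, hw, ha⟩ := terminal_prefix_split heq (.inl (G.lhs_ne _))
    rw [← hb, ← List.append_assoc, ← List.append_assoc, List.append_cancel_right_eq] at ha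
    obtain ⟨a', h', hd⟩ := ih (i := i + 1) (a := w₂.map Sum.inr ++ (G.rhs (d i) ++ b))
      (by simp [hs' i, hw, ← hb]) (fun j h1 h2 => hc j (by omega) (by omega))
    refine ⟨a', by rw [← h']; congr 1; omega, ?_⟩
    rw [List.range'_succ, List.map_cons]
    exact .cons (lstep_iff.2 ⟨w₂, b, by simpa using ha, rfl⟩) hd

/-- The part of an infinite leftmost derivation between two successive positions of a spine. -/
theorem spine_step (hs : ∀ i, s i = (w i).map Sum.inr ++ ((G.lhs (d i)).map Sum.inl ++ v i))
    (hs' : ∀ i, s (i + 1) = (w i).map Sum.inr ++ (G.rhs (d i) ++ v i)) {t t' : ℕ} (htt' : t < t')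
    (hle : (v t).length ≤ (v t').length)
    (hlt : ∀ j, t < j → j < t' → (v t').length < (v j).length) {q : List G.N} {X : G.N}
    (hq : G.lhs (d t') = q ++ [X]) :
    ∃ w' α γ, w t' = w t ++ w' ∧ G.rhs (d t) = α ++ Sum.inl X :: γ ∧
      G.LDeriv α ((List.range' (t + 1) (t' - (t + 1))).map d)
        (w'.map Sum.inr ++ q.map Sum.inl) := by
  obtain ⟨α, c, hαc, hc⟩ : ∃ α c, G.rhs (d t) ++ v t = α ++ c ∧ c.length = (v t').length + 1 := by
    obtain ⟨w₂, -, h⟩ := terminal_prefix_split ((hs' t).symm.trans (hs (t + 1)))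
      (.inl (G.lhs_ne _))
    have h1 : (v t').length ≤ (v (t + 1)).length := by
      rcases eq_or_lt_of_le (Nat.succ_le_of_lt htt') with rfl | hlt'
      · exact le_rfl
      · exact (hlt _ t.lt_succ_self hlt').le
    have h2 := List.length_pos_iff.2 (G.lhs_ne (d (t + 1)))
    have h3 := congrArg List.length h
    rw [List.length_append, List.length_append, List.length_append, List.length_map,
      List.length_map] at h3
    refine ⟨_, _, (List.take_append_drop
      ((G.rhs (d t) ++ v t).length - ((v t').length + 1)) _).symm, ?_⟩
    rw [List.length_drop, List.length_append]
    omega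
  obtain ⟨a', h, hd⟩ := lderiv_of_length_le hs hs' (t' - (t + 1)) (i := t + 1) (a := α) (c := c)
    (w₀ := w t) (by rw [hs', hαc]) (fun j h1 h2 => hc ▸ hlt j (by omega) (by omega))
  rw [Nat.add_sub_cancel' htt', hs t'] at h
  obtain ⟨w', hw', h⟩ := terminal_prefix_split h.symm (.inl (G.lhs_ne _))
  obtain ⟨hα, rfl⟩ : a' = w'.map Sum.inr ++ q.map Sum.inl ∧ c = Sum.inl X :: v t' := by
    refine List.append_inj' ?_ (by simpa using hc)
    simpa [hq] using h
  obtain ⟨γ, hγ⟩ : v t <:+ v t' := List.suffix_of_suffix_length_le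
    (List.suffix_append _ _) (l₃ := G.rhs (d t) ++ v t) ⟨α ++ [Sum.inl X], by simp [hαc]⟩ hle
  refine ⟨w', α, γ, hw', ?_, hα ▸ hd⟩
  rw [← hγ] at hαc
  exact List.append_cancel_right (bs := v t) (by simpa using hαc)

/-- The ε-free grammar simulates the part of a derivation between two positions of a spine. -/
theorem generates_spine [Finite T] {ρ : AccRho} {p : G.P} {q q' : G.Buffer} {A X : G.N}
    {α γ : List (G.N ⊕ T)} {ps : List G.P} {w' : List T} (hp : G.lhs p = q.1 ++ [A])
    (hrhs : G.rhs p = α ++ Sum.inl X :: γ)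
    (h : G.LDeriv α ps (w'.map Sum.inr ++ q'.1.map Sum.inl)) :
    Generates ρ [Sum.inl (q, Sum.inl A, none)] (insert p {p' | p' ∈ ps})
      (w'.map Sum.inr ++ [Sum.inl (q', Sum.inl X, none)]) := by
  rcases eq_or_ne w' [] with rfl | hw
  · simpa using (Rule.expand hp hrhs ⟨ps, h, rfl⟩ (.last (.endless γ))).generates (ρ := ρ) (.refl _)
  · obtain ⟨e, z, q₁, E, L, y, rfl, he, hc, hg, hL⟩ := LDeriv.exists_generates (ρ := ρ)
      (q := G.emptyBuffer) (r := q') h (firstExceeds_nil_left _) hw ∅ q'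
    have hc' := hc.append (.refl _) (.last (q := q') (Z := Sum.inl X) (.endless γ))
    have := (Rule.expand (z := z ++ ([] ++ Sum.inl X :: γ)) hp (by simp [hrhs]) he hc').generates
      (by simpa using hg.append (.refl [Sum.inl (q', Sum.inl X, none)]))
    rwa [Set.insert_union, hL, Set.union_empty] at this

end OmegaPSG

end OmegaFormal

namespace OmegaFormal.OmegaPSG

variable {T : Type} {G : OmegaPSG T} [Finite T] {σ : AccSigma} {ρ : AccRho}

theorem lang_subset_epsFree : G.Lang σ ρ DerivMode.l ⊆ (G.epsFree ρ).Lang σ ρ DerivMode.l := by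
  rintro u ⟨s, d, h0, hstep, hunb, hu, hacc⟩
  have hlhs : ∀ p, ∃ (q : G.Buffer) (A : G.N), G.lhs p = q.1 ++ [A] := by
    intro p
    obtain h | ⟨q, A, h⟩ := List.eq_nil_or_concat (G.lhs p)
    · exact absurd h (G.lhs_ne p)
    · refine ⟨⟨q, ?_⟩, A, by simpa using h⟩
      have := (G.length_le_bound p).1
      simp only [h, List.length_concat] at this
      omega
  choose q X hqX using hlhs
  choose w v hs hs' using fun i => lstep_iff.1 (hstep i)
  have hprefix : ∀ i, termPrefix (s i) = w i := by
    intro i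
    obtain ⟨A, l, hl⟩ := List.exists_cons_of_ne_nil (G.lhs_ne (d i))
    simp [hs i, termPrefix_append, hl, termPrefix]
  simp only [hprefix] at hunb hu
  have hmono : Monotone fun i => (w i).length := monotone_nat_of_le_succ fun i => by
    simpa only [hprefix] using (LStep.termPrefix_prefix (hstep i)).length_le
  obtain ⟨hw0, hv0, hd0⟩ : w 0 = [] ∧ v 0 = [] ∧ G.lhs (d 0) = [G.start] := by
    have h := h0.symm.trans (hs 0)
    obtain ⟨A, l, hl⟩ := List.exists_cons_of_ne_nil (G.lhs_ne (d 0))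
    rw [hl] at h ⊢
    rcases hw : w 0 with _ | ⟨a, w'⟩
    · simp only [hw, List.map_nil, List.map_cons, List.nil_append, List.cons_append,
        List.cons.injEq, Sum.inl.injEq, List.nil_eq, List.append_eq_nil_iff,
        List.map_eq_nil_iff] at h
      simp [h]
    · simp [hw] at h
  obtain ⟨t, ht0, htmono, hle, hlt⟩ := exists_spine (fun i => (v i).length) (by simp [hv0])
  have hgen : ∀ n, ∃ w', w (t (n + 1)) = w (t n) ++ w' ∧
      Generates ρ [Sum.inl (q (d (t n)), Sum.inl (X (d (t n))), none)]
        {p | ∃ j, t n ≤ j ∧ j < t (n + 1) ∧ d j = p} (w'.map Sum.inr ++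
          [Sum.inl (q (d (t (n + 1))), Sum.inl (X (d (t (n + 1)))), none)]) := by
    intro n
    have hn : t n < t (n + 1) := htmono n.lt_succ_self
    obtain ⟨w', α, γ, hw', hrhs, hα⟩ := spine_step hs hs' hn (hle n) (hlt n) (hqX _)
    refine ⟨w', hw', ?_⟩
    convert generates_spine (hqX _) hrhs hα using 1
    ext p
    simp only [Set.mem_ofPred_eq, Set.mem_insert_iff, List.mem_map, List.mem_range'_1]
    constructor
    · rintro ⟨j, h1, h2, rfl⟩
      rcases eq_or_lt_of_le h1 with rfl | h1
      · exact .inl rfl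
      · exact .inr ⟨j, by omega, rfl⟩
    · rintro (rfl | ⟨j, hj, rfl⟩)
      · exact ⟨t n, le_rfl, hn, rfl⟩
      · exact ⟨j, by omega, by omega, rfl⟩
  choose w' hw' ts hts hlabels using hgen
  refine mem_lang_of_blocks (fun n => (w (t n)).map Sum.inr ++
    [Sum.inl (q (d (t n)), Sum.inl (X (d (t n))), none)]) (fun n => w (t n)) ts ?_
    (fun n => by simp [termPrefix_append]) (fun n => ?_) (fun k => ?_) (fun n => hu _) ?_
  · have h := hd0.symm.trans (hqX (d 0))
    obtain ⟨hq, hX⟩ := List.append_inj' (s₁ := []) h (by simp)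
    have hq' : q (d 0) = G.emptyBuffer := Subtype.ext hq.symm
    simp [ht0, hw0, hq', show X (d 0) = G.start by simpa using hX.symm]
  · simpa [hw'] using (hts n).context (w (t n)) []
  · obtain ⟨i, hi⟩ := hunb k
    exact ⟨i, hi.trans (hmono (htmono.le_apply))⟩
  · rw [exists_mem_epsFree_acc_iff]
    have : ∀ n, ⋃ t ∈ {r | r ∈ ts n}, RuleName.label t =
        {p | ∃ j, t n ≤ j ∧ j < t (n + 1) ∧ d j = p} := by
      intro n
      rw [← hlabels n]
      ext
      simp [labels]
    simp only [this]
    rwa [sigmaSetSeq_blocks σ d t ht0 htmono.monotone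
      fun k => ⟨k + 1, k.lt_succ_self.trans_le htmono.le_apply⟩]

theorem epsFree_lang : (G.epsFree ρ).Lang σ ρ DerivMode.l = G.Lang σ ρ DerivMode.l :=
  epsFree_lang_subset.antisymm lang_subset_epsFree

variable (G ρ) in
theorem isCFG_epsFree : (G.epsFree ρ).IsCFG := fun _ => rfl

variable (G ρ) in
theorem isCSG_epsFree : (G.epsFree ρ).IsCSG := fun t => List.length_pos_iff.2 t.2.rhs_ne_nil

end OmegaFormal.OmegaPSG

/-- Theorem: 𝓛_{σ,ρ,l}(ω-CSG) = 𝓛_{σ,ρ,l}(ω-CFG) for (σ,ρ) ∉ {(ran,⊓), (ran,=)}. -/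
theorem csg_l_eq_cfg_l (T : Type) [Fintype T] (σ : AccSigma) (ρ : AccRho)
    (h1 : (σ, ρ) ≠ (AccSigma.ran, AccRho.cap)) (h2 : (σ, ρ) ≠ (AccSigma.ran, AccRho.eq)) :
    GLang T OmegaPSG.IsCSG σ ρ DerivMode.l = GLang T OmegaPSG.IsCFG σ ρ DerivMode.l := by
  ext L
  constructor
  · rintro ⟨G, -, rfl⟩
    exact ⟨G.epsFree ρ, G.isCFG_epsFree ρ, OmegaPSG.epsFree_lang.symm⟩
  · rintro ⟨G, -, rfl⟩
    exact ⟨G.epsFree ρ, G.isCSG_epsFree ρ, OmegaPSG.epsFree_lang.symm⟩
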